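/- arXiv:2312.04629 — 3 statements merged into one kernel-verified Lean document; each statement's English description precedes it below -/
import Mathlib

section
/- For every real s, the improper integral ∫₀^∞ sin(2 s η)/sinh(η) dη equals (π/2) tanh(π s). -/
open MeasureTheory Real

lemma aux_coth (t : ℝ) (ht : t ≠ 0) :
    HasSum (fun n : ℕ => 2 * t / (t ^ 2 + ((n : ℝ) + 1) ^ 2))
      (π * (cosh (π * t) / sinh (π * t)) - 1 / t) := by
  have hx : (t * Complex.I : ℂ) ∈ Complex.integerComplement := by
    rw [Complex.mem_integerComplement_iff]
    rintro ⟨n, hn⟩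
    have := congrArg Complex.im hn
    simp at this
    exact ht this.symm
  have h1 := (summable_cotTerm hx).hasSum
  have h2 := cot_series_rep' hx
  simp only [cotTerm] at h1
  rw [← h2] at h1
  have h3 := h1.mul_left Complex.I
  rw [← Complex.hasSum_ofReal]
  have htc : (t : ℂ) ≠ 0 := by exact_mod_cast ht
  have hI : Complex.I ^ 2 = -1 := Complex.I_sq
  convert! h3 using 1
  · ext n
    have hp : (t : ℂ) ^ 2 + ((n : ℂ) + 1) ^ 2 ≠ 0 := by
      have : t ^ 2 + ((n : ℝ) + 1) ^ 2 ≠ 0 := by positivity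
      exact_mod_cast this
    have e : (t * Complex.I - (n + 1)) * (t * Complex.I + (n + 1))
        = -((t : ℂ) ^ 2 + ((n : ℂ) + 1) ^ 2) := by
      linear_combination (t : ℂ) ^ 2 * hI
    have hne : (t * Complex.I - (n + 1)) * (t * Complex.I + (n + 1)) ≠ 0 := by
      rw [e]; exact neg_ne_zero.mpr hp
    have ha := left_ne_zero_of_mul hne
    have hb := right_ne_zero_of_mul hne
    rw [one_div_add_one_div ha hb, e]
    push_cast
    rw [div_neg, eq_comm]
    field_simp
    linear_combination (-2 : ℂ) * t * hI
  · rw [Complex.cot_eq_cos_div_sin, ← mul_assoc, Complex.cos_mul_I, Complex.sin_mul_I]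
    have hs : Complex.sinh (π * t) ≠ 0 := by
      have : sinh (π * t) ≠ 0 := by
        rw [Ne, Real.sinh_eq_zero]; positivity
      exact_mod_cast this
    push_cast
    field_simp

lemma aux_tanh (s : ℝ) (hs : s ≠ 0) :
    HasSum (fun n : ℕ => 4 * s / ((2 * (n : ℝ) + 1) ^ 2 + 4 * s ^ 2))
      (π / 2 * tanh (π * s)) := by
  have h1 := aux_coth s hs
  have h2 := (aux_coth (2 * s) (by positivity)).mul_left 2
  set f : ℕ → ℝ := fun n => 2 * (2 * (2 * s) / ((2 * s) ^ 2 + ((n : ℝ) + 1) ^ 2)) with hf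
  have ho : HasSum (fun k => f (2 * k + 1)) (π * (cosh (π * s) / sinh (π * s)) - 1 / s) := by
    convert! h1 using 1
    ext k
    simp only [hf]
    push_cast
    have : (s ^ 2 + ((k : ℝ) + 1) ^ 2) ≠ 0 := by positivity
    rw [show (2 * s) ^ 2 + (2 * (k : ℝ) + 1 + 1) ^ 2 = 4 * (s ^ 2 + ((k : ℝ) + 1) ^ 2) by ring]
    field_simp
    ring
  have he : Summable (fun k => f (2 * k)) :=
    h2.summable.comp_injective (fun a b h => by simpa using h)
  have h3 := (he.hasSum.even_add_odd ho).unique h2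
  have h4 := he.hasSum.div_const 2
  have hS : sinh (π * s) ≠ 0 := by
    rw [Ne, Real.sinh_eq_zero]; positivity
  have hC : cosh (π * s) ≠ 0 := (Real.cosh_pos _).ne'
  convert! h4 using 1
  · ext k
    simp only [hf]
    push_cast
    rw [add_comm ((2 * (k : ℝ) + 1) ^ 2)]
    ring
  · rw [eq_sub_of_add_eq h3, show π * (2 * s) = 2 * (π * s) by ring, Real.sinh_two_mul,
      Real.cosh_two_mul, Real.tanh_eq_sinh_div_cosh]
    field_simp
    ring

lemma aux_int1 (a : ℝ) (ha : 0 < a) :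
    ∫ t in Set.Ioi (0 : ℝ), t * exp (-(a * t)) = 1 / a ^ 2 := by
  have := Real.integral_rpow_mul_exp_neg_mul_Ioi (a := 2) (r := a) two_pos ha
  norm_num at this
  simpa using this

lemma aux_intble (a : ℝ) (ha : 0 < a) :
    IntegrableOn (fun t : ℝ => t * exp (-(a * t))) (Set.Ioi 0) :=
  .of_integral_ne_zero (by rw [aux_int1 a ha]; positivity)

lemma aux_int2 (a b : ℝ) (ha : 0 < a) :
    ∫ t in Set.Ioi (0 : ℝ), sin (b * t) * exp (-(a * t)) = b / (a ^ 2 + b ^ 2) := by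
  have hre : (-(a : ℂ) + b * Complex.I).re < 0 := by simpa using ha
  have h := integral_exp_mul_complex_Ioi hre 0
  have hi := integrableOn_exp_mul_complex_Ioi hre 0
  have h2 := integral_im hi
  have e : ∀ t : ℝ, RCLike.im (Complex.exp ((-(a : ℂ) + b * Complex.I) * t))
      = sin (b * t) * exp (-(a * t)) := by
    intro t
    simp [Complex.exp_im, mul_comm]
  simp_rw [e] at h2
  rw [h2, h]
  have : a ^ 2 + b ^ 2 ≠ 0 := by positivity
  simp [Complex.inv_im, Complex.normSq_apply, neg_div]
  field_simp

/-- For every real `s`, `∫₀^∞ sin(2sη)/sinh(η) dη = (π/2) tanh(π s)`. -/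
theorem integral_sin_div_sinh (s : ℝ) :
    ∫ η in Set.Ioi (0 : ℝ), Real.sin (2*s*η) / Real.sinh η
      = (Real.pi/2) * Real.tanh (Real.pi * s) := by
  rcases eq_or_ne s 0 with rfl | hs
  · simp
  set F : ℕ → ℝ → ℝ := fun n t => 2 * (sin (2 * s * t) * exp (-((2 * (n : ℝ) + 1) * t))) with hF
  have hpos : ∀ n : ℕ, (0 : ℝ) < 2 * n + 1 := fun n => by positivity
  have hdom : ∀ n : ℕ, IntegrableOn
      (fun t : ℝ => 4 * |s| * (t * exp (-((2 * (n : ℝ) + 1) * t)))) (Set.Ioi 0) :=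
    fun n => (aux_intble _ (hpos n)).const_mul _
  have hle : ∀ n : ℕ, ∀ t ∈ Set.Ioi (0 : ℝ),
      ‖F n t‖ ≤ 4 * |s| * (t * exp (-((2 * (n : ℝ) + 1) * t))) := by
    intro n t ht
    have h1 : |sin (2 * s * t)| ≤ 2 * |s| * t := by
      refine (Real.abs_sin_le_abs).trans ?_
      rw [abs_mul, abs_mul, abs_of_pos (Set.mem_Ioi.mp ht), abs_two]
    simp only [hF, norm_mul, Real.norm_eq_abs, abs_two, Real.abs_exp]
    calc _ ≤ 2 * ((2 * |s| * t) * exp (-((2 * (n : ℝ) + 1) * t))) := by gcongr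
      _ = _ := by ring
  have hint : ∀ n, IntegrableOn (F n) (Set.Ioi 0) := by
    intro n
    refine Integrable.mono' (hdom n) ?_ ?_
    · exact Continuous.aestronglyMeasurable (by fun_prop)
    · exact (ae_restrict_iff' measurableSet_Ioi).mpr (ae_of_all _ (hle n))
  have hsum : Summable fun n => ∫ t in Set.Ioi (0 : ℝ), ‖F n t‖ := by
    have hs2 : Summable (fun n : ℕ => 4 * |s| * (1 / (2 * (n : ℝ) + 1) ^ 2)) := by
      apply Summable.mul_left
      have h := (Real.summable_one_div_nat_pow (p := 2)).mpr one_lt_two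
      have := h.comp_injective (i := fun n : ℕ => 2 * n + 1) (fun a b h => by simpa using h)
      simpa [Function.comp_def] using this
    refine Summable.of_nonneg_of_le (fun n => integral_nonneg fun t => norm_nonneg _) ?_ hs2
    intro n
    rw [← aux_int1 _ (hpos n), ← integral_const_mul]
    exact setIntegral_mono_on (hint n).norm (hdom n) measurableSet_Ioi (hle n)
  have key := hasSum_integral_of_summable_integral_norm hint hsum
  have e1 : ∀ n, ∫ t in Set.Ioi (0 : ℝ), F n t = 4 * s / ((2 * (n : ℝ) + 1) ^ 2 + 4 * s ^ 2) := by
    intro n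
    simp only [hF]
    rw [integral_const_mul, aux_int2 _ _ (hpos n)]
    ring
  simp_rw [e1] at key
  rw [← key.unique (aux_tanh s hs)]
  refine setIntegral_congr_fun measurableSet_Ioi fun t ht => ?_
  have ht : 0 < t := ht
  have hq : exp (-(2 * t)) < 1 := by rw [Real.exp_lt_one_iff]; linarith
  have hg := (hasSum_geometric_of_lt_one (exp_pos _).le hq).mul_left
    (2 * sin (2 * s * t) * exp (-t))
  have e2 : (fun n : ℕ => 2 * sin (2 * s * t) * exp (-t) * exp (-(2 * t)) ^ n)
      = fun n => F n t := by
    ext n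
    simp only [hF]
    rw [← Real.exp_nat_mul, mul_assoc, ← Real.exp_add, mul_assoc]
    ring_nf
  rw [e2] at hg
  rw [hg.tsum_eq, Real.sinh_eq]
  have h5 : exp (-(2 * t)) = exp (-t) * exp (-t) := by rw [← Real.exp_add]; ring_nf
  have h6 : exp t * exp (-t) = 1 := by rw [← Real.exp_add]; simp
  have h7 : exp t - exp (-t) ≠ 0 := by
    have : exp (-t) < exp t := by rw [Real.exp_lt_exp]; linarith
    linarith
  have h8 : 1 - exp (-(2 * t)) = exp (-t) * (exp t - exp (-t)) := by rw [h5]; linarith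
  rw [h8]
  have := (exp_pos (-t)).ne'
  field_simp
end

section
/- For all real s, t, the improper integral ∫_{-∞}^∞ e^{i(s+t)η} · η cos(η(s-t))/sinh(η) dη equals (π²/4) [sech²(π s) + sech²(π t)]. -/
open MeasureTheory Complex


lemma auxA_norm (c : ℂ) (x : ℝ) (hx : 0 < x) :
    ‖(x : ℂ) * cexp (-c * x)‖ = x ^ (1:ℝ) * Real.exp (-c.re * x) := by
  rw [norm_mul, Complex.norm_exp]
  simp [abs_of_pos hx]

lemma auxA_int (c : ℂ) (hc : 0 < c.re) :
    IntegrableOn (fun x : ℝ => (x : ℂ) * cexp (-c * x)) (Set.Ioi 0) := by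
  have h := integrableOn_rpow_mul_exp_neg_mul_rpow (p := 1) (s := 1) (b := c.re)
    (by norm_num) one_pos hc
  refine Integrable.mono h (by fun_prop) ?_
  refine (ae_restrict_mem measurableSet_Ioi).mono fun x hx => ?_
  rw [auxA_norm c x hx, Real.rpow_one x]
  exact le_abs_self _

lemma auxA (c : ℂ) (hc : 0 < c.re) :
    ∫ x : ℝ in Set.Ioi 0, (x : ℂ) * cexp (-c * x) = 1 / c ^ 2 := by
  have hc0 : c ≠ 0 := by rintro rfl; simp at hc
  have t1 : Filter.Tendsto (fun x : ℝ => (x : ℂ) * cexp (-c * x)) Filter.atTop (nhds 0) := by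
    rw [tendsto_zero_iff_norm_tendsto_zero]
    refine (tendsto_rpow_mul_exp_neg_mul_atTop_nhds_zero 1 c.re hc).congr' ?_
    filter_upwards [Filter.eventually_gt_atTop 0] with x hx
    rw [auxA_norm c x hx]
  have t0 : Filter.Tendsto (fun x : ℝ => cexp (-c * x)) Filter.atTop (nhds 0) := by
    rw [tendsto_zero_iff_norm_tendsto_zero]
    refine (tendsto_rpow_mul_exp_neg_mul_atTop_nhds_zero 0 c.re hc).congr' ?_
    filter_upwards [Filter.eventually_gt_atTop 0] with x hx
    rw [Complex.norm_exp]; simp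
  have := integral_Ioi_of_hasDerivAt_of_tendsto' (a := 0) (m := 0)
    (f := fun x : ℝ => -(1/c) * ((x : ℂ) * cexp (-c * x)) - (1/c^2) * cexp (-c*x))
    (f' := fun x : ℝ => (x : ℂ) * cexp (-c * x)) ?_ (auxA_int c hc) ?_
  · rw [this]; simp
  · intro x _
    have h1 : HasDerivAt (fun x : ℝ => (x : ℂ)) 1 x := Complex.ofRealCLM.hasDerivAt
    have h2 : HasDerivAt (fun x : ℝ => cexp (-c * x)) (cexp (-c * x) * (-c * 1)) x :=
      (h1.const_mul (-c)).cexp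
    have h3 := ((h1.fun_mul h2).const_mul (-(1/c))).fun_sub (h2.const_mul (1/c^2))
    refine h3.congr_deriv ?_
    generalize cexp (-c * x) = E
    field_simp
    ring
  · have t2 : Filter.Tendsto (fun x : ℝ => -(1/c) * ((x : ℂ) * cexp (-c * x)))
        Filter.atTop (nhds (-(1/c) * 0)) := Filter.Tendsto.const_mul _ t1
    have t3 : Filter.Tendsto (fun x : ℝ => (1/c^2) * cexp (-c * x))
        Filter.atTop (nhds ((1/c^2) * 0)) := Filter.Tendsto.const_mul _ t0
    have t4 := Filter.Tendsto.sub t2 t3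
    rw [mul_zero, mul_zero, sub_zero] at t4
    exact t4

lemma auxB_int (s : ℝ) :
    IntegrableOn (fun x : ℝ => cexp (2 * I * s * x) * ((x / Real.sinh x : ℝ) : ℂ)) (Set.Ioi 0) := by
  have h := (integrableOn_exp_mul_Ioi (a := -(1/2)) (by norm_num) 0).const_mul 2
  refine Integrable.mono h (Measurable.aestronglyMeasurable (by fun_prop)) ?_
  refine (ae_restrict_mem measurableSet_Ioi).mono fun x (hx : 0 < x) => ?_
  have h1 : ‖cexp (2 * I * s * x)‖ = 1 := by
    rw [Complex.norm_exp]; simp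
  rw [norm_mul, h1, one_mul, Complex.norm_real]
  have hs : 0 < Real.sinh x := Real.sinh_pos_iff.2 hx
  rw [Real.norm_of_nonneg (by positivity), Real.norm_of_nonneg (by positivity), div_le_iff₀ hs]
  have e : Real.sinh x = 2 * Real.sinh (x/2) * Real.cosh (x/2) := by
    rw [← Real.sinh_two_mul]; ring_nf
  have h2 : x / 2 ≤ Real.sinh (x/2) := Real.self_le_sinh_iff.2 (by linarith)
  have h3 : Real.exp (x/2) / 2 ≤ Real.cosh (x/2) := by
    rw [Real.cosh_eq]; have := Real.exp_pos (-(x/2)); linarith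
  have h4 : Real.exp (-(1/2)*x) * Real.exp (x/2) = 1 := by
    rw [← Real.exp_add]; ring_nf; simp
  have h5 : x * Real.exp (x/2) / 2 ≤ Real.sinh x := by
    rw [e]
    have := mul_le_mul h2 h3 (by positivity) (by linarith)
    linarith
  have := mul_le_mul_of_nonneg_left h5 (Real.exp_pos (-(1/2)*x)).le
  have : Real.exp (-(1/2)*x) * (x * Real.exp (x/2) / 2) = x/2 := by
    linear_combination (x/2) * h4
  linarith

lemma auxB_tsum (s x : ℝ) (hx : 0 < x) :
    ∑' n : ℕ, 2 * ((x : ℂ) * cexp (-(2*n+1 - 2*I*s) * x)) =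
      cexp (2 * I * s * x) * ((x / Real.sinh x : ℝ) : ℂ) := by
  have hq : ‖cexp (-2 * x)‖ < 1 := by
    rw [Complex.norm_exp]; simpa using hx
  have h := (hasSum_geometric_of_norm_lt_one hq).mul_left (2 * x * cexp (-x) * cexp (2 * I * s * x))
  have hs : (Real.sinh x : ℂ) ≠ 0 := by exact_mod_cast (Real.sinh_pos_iff.2 hx).ne'
  have h1 : 1 - cexp (-2*x) ≠ 0 := by
    intro h0
    rw [sub_eq_zero] at h0
    rw [← h0] at hq; simp at hq
  convert! h.tsum_eq using 1
  · congr 1; ext n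
    rw [← Complex.exp_nat_mul]
    have : cexp (-(2*n+1 - 2*I*s) * x) = cexp (-x) * cexp (2 * I * s * x) * cexp (n * (-2 * x)) := by
      rw [← Complex.exp_add, ← Complex.exp_add]; ring_nf
    rw [this]; ring
  · have e2 : cexp (-2*x) = cexp (-x) * cexp (-x) := by rw [← Complex.exp_add]; ring_nf
    have e3 : cexp x * cexp (-x) = 1 := by rw [← Complex.exp_add]; simp
    push_cast at hs ⊢
    rw [mul_div_assoc', div_eq_iff hs, ← div_eq_mul_inv, div_mul_eq_mul_div, eq_div_iff h1]
    rw [Complex.sinh, e2]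
    linear_combination (-cexp (2 * I * s * x) * x) * e3

lemma auxB (s : ℝ) :
    HasSum (fun n : ℕ => 2 / (2*n+1 - 2*I*s)^2)
      (∫ x : ℝ in Set.Ioi 0, cexp (2 * I * s * x) * ((x / Real.sinh x : ℝ) : ℂ)) := by
  have hre : ∀ n : ℕ, 0 < (2*n+1 - 2*I*s : ℂ).re := fun n => by simp; positivity
  have h := hasSum_integral_of_summable_integral_norm (μ := volume.restrict (Set.Ioi (0:ℝ)))
    (F := fun (n : ℕ) (x : ℝ) => 2 * ((x : ℂ) * cexp (-(2*n+1 - 2*I*s) * x)))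
    (fun n => (auxA_int _ (hre n)).const_mul 2) ?_
  · rw [setIntegral_congr_fun measurableSet_Ioi (fun x hx => auxB_tsum s x hx)] at h
    convert! h using 2 with n
    rw [integral_const_mul, auxA _ (hre n)]; ring
  · have : ∀ n : ℕ, ∫ x : ℝ in Set.Ioi 0, ‖2 * ((x : ℂ) * cexp (-(2*n+1 - 2*I*s) * x))‖ =
        2 * (1 / (2*n+1))^2 := by
      intro n
      have h2 := Real.integral_rpow_mul_exp_neg_mul_Ioi (a := 2) (r := 2*n+1) two_pos (by positivity)
      have g2 : Real.Gamma 2 = 1 := Real.Gamma_two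
      rw [g2, mul_one, Real.rpow_two] at h2
      rw [← h2, ← integral_const_mul]
      refine setIntegral_congr_fun measurableSet_Ioi fun x hx => ?_
      rw [norm_mul, auxA_norm _ x hx]
      norm_num
      left; ring
    simp_rw [this]
    apply Summable.mul_left
    refine Summable.of_nonneg_of_le (fun n => by positivity) (fun n => ?_)
      ((summable_nat_add_iff 1).2 (Real.summable_one_div_nat_pow.2 one_lt_two))
    rw [one_div_pow]
    push_cast
    gcongr
    linarith [(Nat.cast_nonneg n : (0:ℝ) ≤ n)]

lemma auxC_lb (y : ℂ) (n : ℕ) (h : ((n:ℝ)+1)/4 ≤ |y.re|) : ‖1 / y^2‖ ≤ 16 * (1/((n+1 : ℕ):ℝ)^2) := by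
  have h1 := h.trans (Complex.abs_re_le_norm y)
  have hn : (0:ℝ) < n + 1 := by positivity
  rw [norm_div, norm_pow, norm_one]
  push_cast
  calc 1 / ‖y‖^2 ≤ 1 / (((n:ℝ)+1)/4)^2 := by gcongr
    _ = _ := by field_simp; norm_num

lemma auxC_summ : Summable fun n : ℕ => 16 * (1/((n+1 : ℕ):ℝ)^2) :=
  ((summable_nat_add_iff (f := fun n : ℕ => 1/(n:ℝ)^2) 1).2 (Real.summable_one_div_nat_pow.2 one_lt_two)).mul_left 16

lemma auxC_b1 (z : ℂ) (hz : 1/4 < z.re ∧ z.re < 3/4) (n : ℕ) :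
    ‖1 / (z - (n+1))^2‖ ≤ 16 * (1/((n+1 : ℕ):ℝ)^2) := by
  apply auxC_lb
  have hn : (0:ℝ) ≤ n := by positivity
  simp
  rw [abs_of_neg (by linarith)]; linarith

lemma auxC_b2 (z : ℂ) (hz : 1/4 < z.re ∧ z.re < 3/4) (n : ℕ) :
    ‖1 / (z + (n+1))^2‖ ≤ 16 * (1/((n+1 : ℕ):ℝ)^2) := by
  apply auxC_lb
  have hn : (0:ℝ) ≤ n := by positivity
  simp
  rw [abs_of_pos (by linarith)]; linarith

lemma auxC_mem (z : ℂ) (hz : 1/4 < z.re ∧ z.re < 3/4) : z ∈ Complex.integerComplement := by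
  rintro ⟨m, rfl⟩
  simp at hz
  have h1 : (0:ℝ) < m := by linarith
  have h2 : (m:ℝ) < 1 := by linarith
  norm_cast at h1 h2
  omega

lemma auxC (z : ℂ) (hz : 1/4 < z.re ∧ z.re < 3/4) :
    ∑' n : ℕ, (1 / (z - (n+1))^2 + 1 / (z + (n+1))^2) =
      Real.pi^2 / Complex.sin (Real.pi * z)^2 - 1 / z^2 := by
  set t : Set ℂ := {w | 1/4 < w.re ∧ w.re < 3/4} with ht
  have hto : IsOpen t :=
    (isOpen_lt continuous_const Complex.continuous_re).inter
      (isOpen_lt Complex.continuous_re continuous_const)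
  have htc : IsPreconnected t :=
    ((convex_halfSpace_re_gt (1/4)).inter (convex_halfSpace_re_lt (3/4))).isPreconnected
  have key := hasDerivAt_tsum_of_isPreconnected (t := t) (y₀ := z) (y := z)
    (g := fun (n : ℕ) (w : ℂ) => 1 / (w - (n+1)) + 1 / (w + (n+1)))
    (g' := fun (n : ℕ) (w : ℂ) => -(1 / (w - (n+1))^2 + 1 / (w + (n+1))^2))
    (auxC_summ.add auxC_summ) hto htc ?_ ?_ hz (summable_cotTerm (auxC_mem z hz)) hz
  · have hsin : Complex.sin (Real.pi * z) ≠ 0 := by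
      exact sin_pi_mul_ne_zero (auxC_mem z hz)
    have hz0 : z ≠ 0 := by rintro rfl; norm_num at hz
    have h2 : HasDerivAt (fun w : ℂ => Real.pi * Complex.cot (Real.pi * w) - 1 / w)
        (-(Real.pi^2 / Complex.sin (Real.pi * z)^2) + 1 / z^2) z := by
      have hl : HasDerivAt (fun w : ℂ => Real.pi * w) Real.pi z := by
        simpa using (hasDerivAt_id z).const_mul (Real.pi : ℂ)
      have hc := (hl.ccos.div hl.csin hsin).const_mul (Real.pi : ℂ)
      have hi := hasDerivAt_inv hz0
      have := hc.sub hi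
      simp only [Complex.cot, one_div]
      convert! this using 1
      have := Complex.sin_sq_add_cos_sq (Real.pi * z)
      field_simp
      linear_combination (z^2 * Real.pi^2) * this
    have h3 := h2.congr_of_eventuallyEq (f₁ := fun w : ℂ => ∑' n : ℕ, (1 / (w - (n+1)) + 1 / (w + (n+1)))) (by
      filter_upwards [hto.mem_nhds hz] with w hw
      exact (cot_series_rep' (auxC_mem w hw)).symm)
    have h4 := key.unique h3
    rw [tsum_neg] at h4
    linear_combination -h4
  · intro n w hw
    have n1 : w - (n+1) ≠ 0 := by
      simpa [sub_eq_add_neg] using integerComplement_add_ne_zero (auxC_mem w hw) (-(n + 1))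
    have n2 : w + (n+1) ≠ 0 := by
      simpa using integerComplement_add_ne_zero (auxC_mem w hw) (n + 1)
    have a1 := ((hasDerivAt_id w).sub_const ((n:ℂ)+1)).inv n1
    have a2 := ((hasDerivAt_id w).add_const ((n:ℂ)+1)).inv n2
    simp only [one_div]
    convert! a1.add a2 using 1
    simp only [id]
    ring
  · intro n w hw
    rw [norm_neg]
    exact (norm_add_le _ _).trans (add_le_add (auxC_b1 w hw n) (auxC_b2 w hw n))

lemma auxD_J (s : ℝ) :
    (∫ x : ℝ in Set.Ioi 0, cexp (2 * I * s * x) * ((x / Real.sinh x : ℝ) : ℂ)) +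
    (∫ x : ℝ in Set.Ioi 0, cexp (2 * I * (-s : ℝ) * x) * ((x / Real.sinh x : ℝ) : ℂ)) =
      Real.pi^2/2 * (1 / (Complex.cosh (Real.pi * s))^2) := by
  set z : ℂ := 1/2 + I * s with hzdef
  have hz : 1/4 < z.re ∧ z.re < 3/4 := by
    constructor <;> simp [hzdef] <;> norm_num
  have s1 : Summable fun n : ℕ => 1 / (z - (n+1))^2 :=
    Summable.of_norm_bounded auxC_summ (auxC_b1 z hz)
  have s2 : Summable fun n : ℕ => 1 / (z + (n+1))^2 :=
    Summable.of_norm_bounded auxC_summ (auxC_b2 z hz)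
  have h := auxC z hz
  rw [s1.tsum_add s2] at h
  have e1 := (auxB s).tsum_eq
  have e2 := (auxB (-s)).tsum_eq
  have f1 : ∀ n : ℕ, 2 / (2*n+1 - 2*I*s)^2 = (1/2) * (1 / (z - (n+1))^2) := by
    intro n
    rw [show (2*n+1 - 2*I*s : ℂ) = (-2) * (z - (n+1)) by rw [hzdef]; ring, mul_pow, div_mul_eq_div_div, mul_one_div]
    norm_num
  have f2 : ∀ n : ℕ, 2 / (2*n+1 - 2*I*(-s : ℝ))^2 = (1/2) * (1 / (z + n)^2) := by
    intro n
    rw [show (2*n+1 - 2*I*(-s : ℝ) : ℂ) = 2 * (z + n) by rw [hzdef]; push_cast; ring, mul_pow, div_mul_eq_div_div, mul_one_div]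
    norm_num
  simp_rw [f1] at e1
  simp_rw [f2] at e2
  rw [tsum_mul_left] at e1 e2
  have s3 : Summable fun n : ℕ => 1 / (z + n)^2 := by
    rw [← summable_nat_add_iff 1]; simpa using s2
  rw [s3.tsum_eq_zero_add] at e2
  simp only [Nat.cast_add, Nat.cast_one, Nat.cast_zero] at e2
  have hs : Complex.sin (Real.pi * z) = Complex.cosh (Real.pi * s) := by
    rw [← Complex.cos_mul_I, ← Complex.sin_add_pi_div_two, hzdef]
    ring_nf
  rw [hs] at h
  rw [← e1, ← e2]
  simp only [add_zero]
  linear_combination (1/2) * h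

lemma auxD_flip (s x : ℝ) :
    cexp (2 * I * s * (-x : ℝ)) * (((-x) / Real.sinh (-x) : ℝ) : ℂ) =
    cexp (2 * I * (-s : ℝ) * x) * ((x / Real.sinh x : ℝ) : ℂ) := by
  rw [Real.sinh_neg, neg_div_neg_eq]
  push_cast
  ring_nf

lemma auxD_int (s : ℝ) :
    IntegrableOn (fun x : ℝ => cexp (2 * I * s * x) * ((x / Real.sinh x : ℝ) : ℂ)) (Set.Iic 0) := by
  have h := auxB_int (-s)
  simp_rw [← auxD_flip] at h
  rw [← integrableOn_Ici_iff_integrableOn_Ioi] at h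
  have := ((Measure.measurePreserving_neg (volume : Measure ℝ)).integrableOn_comp_preimage
    (Homeomorph.neg ℝ).measurableEmbedding (s := Set.Iic 0)
    (f := fun x : ℝ => cexp (2 * I * s * x) * ((x / Real.sinh x : ℝ) : ℂ))).1
  apply this
  simpa [Function.comp_def] using h

lemma auxD (s : ℝ) :
    Integrable (fun x : ℝ => cexp (2 * I * s * x) * ((x / Real.sinh x : ℝ) : ℂ)) ∧
    ∫ x : ℝ, cexp (2 * I * s * x) * ((x / Real.sinh x : ℝ) : ℂ) =
      Real.pi^2/2 * (1 / (Complex.cosh (Real.pi * s))^2) := by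
  constructor
  · rw [← integrableOn_univ, ← Set.Iic_union_Ioi (a := (0:ℝ))]
    exact (auxD_int s).union (auxB_int s)
  · rw [← intervalIntegral.integral_Iic_add_Ioi (auxD_int s) (auxB_int s), ← auxD_J, add_comm]
    congr 1
    have := integral_comp_neg_Ioi 0
      (fun x : ℝ => cexp (2 * I * s * x) * ((x / Real.sinh x : ℝ) : ℂ))
    simp_rw [auxD_flip] at this
    rw [this, neg_zero]

/-- For all real `s, t`,
`∫_{-∞}^∞ e^{i(s+t)η} · η cos(η(s-t))/sinh(η) dη = (π²/4)[sech²(πs) + sech²(πt)]`. -/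
theorem integral_exp_eta_cos_div_sinh (s t : ℝ) :
    ∫ η : ℝ, Complex.exp (Complex.I * (s+t) * η) *
        ((η * Real.cos (η*(s-t)) / Real.sinh η : ℝ) : ℂ)
      = (((Real.pi^2/4) * (1/(Real.cosh (Real.pi*s))^2 + 1/(Real.cosh (Real.pi*t))^2) : ℝ) : ℂ) := by
  have h : ∀ η : ℝ, Complex.exp (Complex.I * (s+t) * η) *
        ((η * Real.cos (η*(s-t)) / Real.sinh η : ℝ) : ℂ) =
      (1/2) * (cexp (2 * I * s * η) * ((η / Real.sinh η : ℝ) : ℂ) +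
        cexp (2 * I * t * η) * ((η / Real.sinh η : ℝ) : ℂ)) := by
    intro η
    push_cast
    have e1 : cexp (2 * I * s * η) = cexp (I * (s+t) * η) * cexp (η * (s-t) * I) := by
      rw [← Complex.exp_add]; ring_nf
    have e2 : cexp (2 * I * t * η) = cexp (I * (s+t) * η) * cexp (-(η * (s-t)) * I) := by
      rw [← Complex.exp_add]; ring_nf
    rw [e1, e2, Complex.cos]
    ring
  simp_rw [h]
  rw [integral_const_mul, integral_add (auxD s).1 (auxD t).1, (auxD s).2, (auxD t).2]
  push_cast
  ring
end

section
/- For ℓ > 0, x ∈ (-ℓ,ℓ) and real s, the limit ε → 0⁺ of ∫_{-ℓ}^{ℓ} Ψ(s,y)/(x - y + iε) dy equals -2πi/(1 + e^{2πs}) · Ψ(s,x), where Ψ(s,y) = √(ℓ/π)(ℓ²-y²)^{-1/2}((ℓ-y)/(ℓ+y))^{is}. -/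
open MeasureTheory Complex Filter

/-- `Ψ(s,y) = √(ℓ/π) (ℓ²-y²)^{-1/2} ((ℓ-y)/(ℓ+y))^{is}`. -/
noncomputable def PsiFun (ℓ s y : ℝ) : ℂ :=
  ((Real.sqrt (ℓ/Real.pi) / Real.sqrt (ℓ^2 - y^2) : ℝ) : ℂ) *
    Complex.exp (Complex.I * s * Real.log ((ℓ-y)/(ℓ+y)))

open Set in
lemma aux_image : (fun t : ℝ => t / (1 + t)) '' Ioi 0 = Ioo 0 1 := by
  ext u
  simp only [mem_image, mem_Ioi, mem_Ioo]
  constructor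
  · rintro ⟨t, ht, rfl⟩
    refine ⟨by positivity, ?_⟩
    rw [div_lt_one (by positivity)]; linarith
  · rintro ⟨h0, h1⟩
    have h2 : 0 < 1 - u := by linarith
    refine ⟨u / (1 - u), by positivity, ?_⟩
    field_simp
    ring

open Set in
lemma aux_inj : InjOn (fun t : ℝ => t / (1 + t)) (Ioi 0) := by
  intro t ht u hu h
  simp only [mem_Ioi] at ht hu
  have h1 : 1 + t ≠ 0 := by positivity
  have h2 : 1 + u ≠ 0 := by positivity
  simp only at h
  rw [div_eq_div_iff h1 h2] at h
  linarith

open Set in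
lemma aux_deriv : ∀ t ∈ Ioi (0:ℝ),
    HasDerivWithinAt (fun t : ℝ => t / (1 + t)) (1 / (1 + t) ^ 2) (Ioi 0) t := by
  intro t ht
  simp only [mem_Ioi] at ht
  have h1 : 1 + t ≠ 0 := by positivity
  have := ((hasDerivAt_id t).div ((hasDerivAt_id t).const_add 1) h1).hasDerivWithinAt (s := Ioi 0)
  convert! this using 1
  simp

lemma aux_point (a : ℂ) (t : ℝ) (ht : 0 < t) :
    |1 / (1 + t) ^ 2| • (((t / (1 + t) : ℝ) : ℂ) ^ (a - 1) *
      (1 - ((t / (1 + t) : ℝ) : ℂ)) ^ ((1 - a) - 1)) = (t : ℂ) ^ (a - 1) / (t + 1) := by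
  have h1 : 0 < 1 + t := by positivity
  have h1c : ((1 + t : ℝ) : ℂ) ≠ 0 := by exact_mod_cast h1.ne'
  have e1 : (1 - ((t / (1 + t) : ℝ) : ℂ)) = (((1 + t)⁻¹ : ℝ) : ℂ) := by
    rw [← Complex.ofReal_one, ← Complex.ofReal_sub]
    congr 1
    field_simp
    ring
  have e2 : ((t / (1 + t) : ℝ) : ℂ) = (t : ℂ) * (((1 + t)⁻¹ : ℝ) : ℂ) := by
    rw [div_eq_mul_inv, Complex.ofReal_mul]
  rw [e1, e2, Complex.mul_cpow_ofReal_nonneg ht.le (by positivity), mul_assoc,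
    ← Complex.cpow_add _ _ (by exact_mod_cast (inv_pos.2 h1).ne'),
    abs_of_pos (by positivity), Complex.real_smul]
  have e3 : a - 1 + ((1 - a) - 1) = -1 := by ring
  rw [e3, Complex.cpow_neg_one]
  push_cast
  push_cast at h1c
  rw [add_comm (t : ℂ) 1]
  field_simp

lemma G_one_int (a : ℂ) (h0 : 0 < a.re) (h1 : a.re < 1) :
    IntegrableOn (fun t : ℝ => (t : ℂ) ^ (a - 1) / (t + 1)) (Set.Ioi 0) := by
  have hb := Complex.betaIntegral_convergent (u := a) (v := 1 - a) h0 (by simpa using h1)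
  rw [intervalIntegrable_iff_integrableOn_Ioo_of_le zero_le_one, ← aux_image,
    integrableOn_image_iff_integrableOn_abs_deriv_smul measurableSet_Ioi aux_deriv aux_inj] at hb
  exact hb.congr_fun (fun t ht => aux_point a t ht) measurableSet_Ioi

lemma G_one (a : ℂ) (h0 : 0 < a.re) (h1 : a.re < 1) :
    ∫ t in Set.Ioi (0:ℝ), (t : ℂ) ^ (a - 1) / (t + 1) = Real.pi / Complex.sin (Real.pi * a) := by
  have hb := Complex.Gamma_mul_Gamma_eq_betaIntegral (s := a) (t := 1 - a) h0 (by simpa using h1)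
  rw [Complex.Gamma_mul_Gamma_one_sub] at hb
  rw [hb]
  simp only [add_sub_cancel, Complex.Gamma_one, one_mul, Complex.betaIntegral]
  rw [intervalIntegral.integral_of_le zero_le_one, integral_Ioc_eq_integral_Ioo, ← aux_image,
    integral_image_eq_integral_abs_deriv_smul measurableSet_Ioi aux_deriv aux_inj]
  exact (setIntegral_congr_fun measurableSet_Ioi (fun t ht => aux_point a t ht)).symm

lemma G_pos (a : ℂ) (h0 : 0 < a.re) (h1 : a.re < 1) (w : ℝ) (hw : 0 < w) :
    ∫ t in Set.Ioi (0:ℝ), (t : ℂ) ^ (a - 1) / (t + (w : ℂ))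
      = Real.pi / Complex.sin (Real.pi * a) * (w : ℂ) ^ (a - 1) := by
  have h := integral_comp_mul_left_Ioi' (fun t : ℝ => (t : ℂ) ^ (a - 1) / (t + (w : ℂ))) 0 hw
  rw [mul_zero] at h
  rw [← h, ← G_one a h0 h1, ← integral_smul, ← integral_mul_const]
  refine setIntegral_congr_fun measurableSet_Ioi (fun t ht => ?_)
  have ht : 0 < t := ht
  have hwc : (w : ℂ) ≠ 0 := by exact_mod_cast hw.ne'
  have h2 : (t : ℂ) + 1 ≠ 0 := by exact_mod_cast (by positivity : t + 1 ≠ 0)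
  simp only [Complex.real_smul]
  rw [Complex.ofReal_mul, Complex.mul_cpow_ofReal_nonneg hw.le ht.le]
  have : (w : ℂ) * t + w = w * (t + 1) := by ring
  rw [this]
  field_simp

lemma slit_bound (K : Set ℂ) (hK : IsCompact K) (hs : K ⊆ Complex.slitPlane) :
    ∃ c : ℝ, 0 < c ∧ ∀ t : ℝ, 0 < t → ∀ w ∈ K, c * (1 + t) ≤ ‖(t : ℂ) + w‖ := by
  rcases K.eq_empty_or_nonempty with rfl | hne
  · exact ⟨1, one_pos, by simp⟩
  have hcpt : IsCompact (Set.Icc (0:ℝ) 1 ×ˢ K) := isCompact_Icc.prod hK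
  have hcont : ContinuousOn (fun p : ℝ × ℂ => ‖(p.1 : ℂ) + (1 - p.1) * p.2‖)
    (Set.Icc (0:ℝ) 1 ×ˢ K) := by fun_prop
  obtain ⟨p, hp, hmin⟩ := hcpt.exists_isMinOn
    (((Set.nonempty_Icc.2 zero_le_one)).prod hne) hcont
  refine ⟨‖(p.1 : ℂ) + (1 - p.1) * p.2‖, ?_, ?_⟩
  · rw [norm_pos_iff]
    apply Complex.slitPlane_ne_zero
    have := Complex.starConvex_one_slitPlane (hs hp.2) hp.1.1
      (show (0:ℝ) ≤ 1 - p.1 by linarith [hp.1.2]) (by ring)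
    simpa using this
  · intro t ht w hw
    have ht1 : 0 < 1 + t := by positivity
    have htc : (1 : ℂ) + t ≠ 0 := by exact_mod_cast ht1.ne'
    have hm := hmin (show ((t / (1 + t), w) : ℝ × ℂ) ∈ Set.Icc (0:ℝ) 1 ×ˢ K from
      ⟨⟨by positivity, by rw [div_le_one ht1]; linarith⟩, hw⟩)
    simp only [Set.mem_ofPred_eq] at hm
    have e : (t : ℂ) + w = (((t / (1 + t) : ℝ) : ℂ) + (1 - ((t / (1 + t) : ℝ) : ℂ)) * w)
        * ((1 + t : ℝ) : ℂ) := by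
      push_cast
      field_simp
      ring
    rw [e, norm_mul, Complex.norm_real, Real.norm_of_nonneg ht1.le]
    exact mul_le_mul_of_nonneg_right hm ht1.le

lemma G_diff (a : ℂ) (h0 : 0 < a.re) (h1 : a.re < 1) :
    DifferentiableOn ℂ (fun w : ℂ => ∫ t in Set.Ioi (0:ℝ), (t : ℂ) ^ (a - 1) / (t + w))
      Complex.slitPlane := by
  intro w₀ hw₀
  apply DifferentiableAt.differentiableWithinAt
  obtain ⟨r, hr, hrs⟩ := Metric.nhds_basis_closedBall.mem_iff.1
    (Complex.isOpen_slitPlane.mem_nhds hw₀)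
  obtain ⟨c, hc, hcb⟩ := slit_bound _ (isCompact_closedBall w₀ r) hrs
  have hint := (G_one_int a h0 h1).norm
  have hn1 : ∀ t : ℝ, 0 < t → ‖(t : ℂ) + 1‖ = 1 + t := by
    intro t ht
    rw [← Complex.ofReal_one, ← Complex.ofReal_add, Complex.norm_real,
      Real.norm_of_nonneg (by positivity), add_comm]
  have hmeas : ∀ w : ℂ, Measurable (fun t : ℝ => (t : ℂ) ^ (a - 1) / (t + w)) := by
    intro w; fun_prop
  have hmeas' : ∀ w : ℂ, Measurable (fun t : ℝ => -((t : ℂ) ^ (a - 1) / (t + w) ^ 2)) := by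
    intro w; fun_prop
  refine (hasDerivAt_integral_of_dominated_loc_of_deriv_le
    (F := fun (w : ℂ) (t : ℝ) => (t : ℂ) ^ (a - 1) / (t + w))
    (F' := fun (w : ℂ) (t : ℝ) => -((t : ℂ) ^ (a - 1) / (t + w) ^ 2))
    (bound := fun t : ℝ => (c⁻¹) ^ 2 * ‖(t : ℂ) ^ (a - 1) / (t + 1)‖)
    (Metric.closedBall_mem_nhds w₀ hr)
    (Eventually.of_forall fun w => (hmeas w).aestronglyMeasurable) ?_
    (hmeas' w₀).aestronglyMeasurable ?_ (hint.const_mul _) ?_).2.differentiableAt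
  · refine Integrable.mono' (hint.const_mul c⁻¹) (hmeas w₀).aestronglyMeasurable ?_
    refine (ae_restrict_iff' measurableSet_Ioi).2 (Eventually.of_forall fun t ht => ?_)
    have ht : 0 < t := ht
    have hb := hcb t ht w₀ (Metric.mem_closedBall_self hr.le)
    rw [norm_div, norm_div, hn1 t ht]
    calc _ ≤ ‖(t : ℂ) ^ (a - 1)‖ / (c * (1 + t)) := by gcongr
      _ = _ := by field_simp
  · refine (ae_restrict_iff' measurableSet_Ioi).2 (Eventually.of_forall fun t ht w hw => ?_)
    have ht : 0 < t := ht
    have hb := hcb t ht w hw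
    rw [norm_neg, norm_div, norm_div, hn1 t ht, norm_pow]
    calc _ ≤ ‖(t : ℂ) ^ (a - 1)‖ / (c * (1 + t)) ^ 2 := by gcongr
      _ = (c⁻¹) ^ 2 * (‖(t : ℂ) ^ (a - 1)‖ / (1 + t)) / (1 + t) := by field_simp
      _ ≤ _ := div_le_self (by positivity) (by linarith)
  · refine (ae_restrict_iff' measurableSet_Ioi).2 (Eventually.of_forall fun t ht w hw => ?_)
    have ht : 0 < t := ht
    have hb := hcb t ht w hw
    have hne : (t : ℂ) + w ≠ 0 := by
      rw [← norm_pos_iff]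
      exact lt_of_lt_of_le (by positivity) hb
    have := (hasDerivAt_const w ((t : ℂ) ^ (a - 1))).div
      ((hasDerivAt_id w).const_add (t : ℂ)) hne
    convert! this using 1
    simp [neg_div]

lemma G_eq (a : ℂ) (h0 : 0 < a.re) (h1 : a.re < 1) (w : ℂ) (hw : w ∈ Complex.slitPlane) :
    ∫ t in Set.Ioi (0:ℝ), (t : ℂ) ^ (a - 1) / (t + w)
      = Real.pi / Complex.sin (Real.pi * a) * w ^ (a - 1) := by
  have hd2 : DifferentiableOn ℂ
      (fun w : ℂ => Real.pi / Complex.sin (Real.pi * a) * w ^ (a - 1)) Complex.slitPlane := by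
    intro w hw
    exact (((differentiableAt_id).cpow_const hw).const_mul _).differentiableWithinAt
  refine ((G_diff a h0 h1).analyticOnNhd Complex.isOpen_slitPlane).eqOn_of_preconnected_of_frequently_eq
    (hd2.analyticOnNhd Complex.isOpen_slitPlane)
    (Complex.starConvex_one_slitPlane.isPathConnected Complex.one_mem_slitPlane).isConnected.isPreconnected
    Complex.one_mem_slitPlane ?_ hw
  have ht : Tendsto (fun x : ℝ => (x : ℂ)) (nhdsWithin 1 (Set.Ioi 1)) (nhdsWithin 1 {1}ᶜ) := by
    refine tendsto_nhdsWithin_iff.2 ⟨?_, ?_⟩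
    · have := (Complex.continuous_ofReal.tendsto 1).mono_left (nhdsWithin_le_nhds (s := Set.Ioi 1))
      simpa using this
    · filter_upwards [self_mem_nhdsWithin] with x hx
      have : (1:ℝ) < x := hx
      simp only [Set.mem_compl_iff, Set.mem_singleton_iff]
      exact_mod_cast this.ne'
  refine ht.frequently (Eventually.frequently ?_)
  filter_upwards [self_mem_nhdsWithin] with x hx
  have hx : (1:ℝ) < x := hx
  exact G_pos a h0 h1 x (by linarith)

open Set in
lemma phi_image (ℓ : ℝ) (hℓ : 0 < ℓ) :
    (fun t : ℝ => ℓ * (1 - t) / (1 + t)) '' Ioi 0 = Ioo (-ℓ) ℓ := by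
  ext u
  simp only [mem_image, mem_Ioi, mem_Ioo]
  constructor
  · rintro ⟨t, ht, rfl⟩
    have : 0 < ℓ * t := by positivity
    constructor
    · rw [lt_div_iff₀ (by positivity)]; nlinarith
    · rw [div_lt_iff₀ (by positivity)]; nlinarith
  · rintro ⟨h0, h1⟩
    have h2 : 0 < ℓ - u := by linarith
    have h3 : 0 < ℓ + u := by linarith
    refine ⟨(ℓ - u) / (ℓ + u), by positivity, ?_⟩
    have h4 : ℓ + u + (ℓ - u) ≠ 0 := by linarith
    field_simp
    ring

open Set in
lemma phi_inj (ℓ : ℝ) (hℓ : 0 < ℓ) : InjOn (fun t : ℝ => ℓ * (1 - t) / (1 + t)) (Ioi 0) := by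
  intro t ht u hu h
  simp only [mem_Ioi] at ht hu
  have h1 : 1 + t ≠ 0 := by positivity
  have h2 : 1 + u ≠ 0 := by positivity
  simp only at h
  rw [div_eq_div_iff h1 h2] at h
  have : 2 * ℓ * (t - u) = 0 := by linarith
  have h3 := (mul_eq_zero.1 this).resolve_left (by positivity)
  linarith

open Set in
lemma phi_deriv (ℓ : ℝ) : ∀ t ∈ Ioi (0:ℝ),
    HasDerivWithinAt (fun t : ℝ => ℓ * (1 - t) / (1 + t)) (-(2 * ℓ / (1 + t) ^ 2)) (Ioi 0) t := by
  intro t ht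
  simp only [mem_Ioi] at ht
  have h1 : 1 + t ≠ 0 := by positivity
  have := ((((hasDerivAt_id t).const_sub 1).const_mul ℓ).div
    ((hasDerivAt_id t).const_add 1) h1).hasDerivWithinAt (s := Ioi 0)
  convert! this using 1
  simp only [id]
  field_simp
  ring

lemma cpow_half (s t : ℝ) (ht : 0 < t) :
    (t : ℂ) ^ ((1 / 2 + Complex.I * s : ℂ) - 1)
      = ((Real.sqrt t)⁻¹ : ℝ) * Complex.exp (Complex.I * s * Real.log t) := by
  have htc : (t : ℂ) ≠ 0 := by exact_mod_cast ht.ne'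
  rw [show (1 / 2 + Complex.I * s : ℂ) - 1 = ((-(1 / 2) : ℝ) : ℂ) + Complex.I * s by
    push_cast; ring, Complex.cpow_add _ _ htc, ← Complex.ofReal_cpow ht.le,
    Real.rpow_neg ht.le, ← Real.sqrt_eq_rpow, Complex.cpow_def_of_ne_zero htc,
    ← Complex.ofReal_log ht.le]
  congr 2
  ring

lemma phi_point (ℓ s x ε t : ℝ) (hℓ : 0 < ℓ) (hε : 0 < ε) (ht : 0 < t) :
    |-(2 * ℓ / (1 + t) ^ 2)| • (PsiFun ℓ s (ℓ * (1 - t) / (1 + t)) /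
        ((x - ℓ * (1 - t) / (1 + t) : ℝ) + Complex.I * ε))
      = (Real.sqrt (ℓ / Real.pi) : ℂ) / (x + Complex.I * ε + ℓ) *
        ((t : ℂ) ^ ((1 / 2 + Complex.I * s : ℂ) - 1) /
          (t + (x + Complex.I * ε - ℓ) / (x + Complex.I * ε + ℓ))) := by
  have h1 : 0 < 1 + t := by positivity
  have e1 : (ℓ - ℓ * (1 - t) / (1 + t)) / (ℓ + ℓ * (1 - t) / (1 + t)) = t := by
    have h : ℓ + ℓ * (1 - t) / (1 + t) = 2 * ℓ / (1 + t) := by field_simp; ring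
    rw [h]; field_simp; ring
  have hsq : Real.sqrt t ^ 2 = t := Real.sq_sqrt ht.le
  have e2 : Real.sqrt (ℓ ^ 2 - (ℓ * (1 - t) / (1 + t)) ^ 2) = 2 * ℓ * Real.sqrt t / (1 + t) := by
    rw [show ℓ ^ 2 - (ℓ * (1 - t) / (1 + t)) ^ 2 = (2 * ℓ * Real.sqrt t / (1 + t)) ^ 2 by
      rw [div_pow, div_pow, mul_pow, mul_pow, mul_pow, hsq]; field_simp; ring]
    exact Real.sqrt_sq (by positivity)
  have hst : 0 < Real.sqrt t := Real.sqrt_pos.2 ht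
  unfold PsiFun
  rw [e1, e2, cpow_half s t ht, abs_neg, abs_of_pos (by positivity), Complex.real_smul]
  have hz : (x + Complex.I * ε + ℓ : ℂ) ≠ 0 := by
    intro h; have := congrArg Complex.im h; simp at this; exact hε.ne' this
  have hd : ((x - ℓ * (1 - t) / (1 + t) : ℝ) + Complex.I * ε : ℂ) ≠ 0 := by
    intro h; have := congrArg Complex.im h
    rw [Complex.add_im, Complex.ofReal_im] at this
    simp at this; exact hε.ne' this
  have h1c : (1 + t : ℂ) ≠ 0 := by exact_mod_cast h1.ne'
  have e3 : (t + (x + Complex.I * ε - ℓ) / (x + Complex.I * ε + ℓ) : ℂ)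
      = ((x - ℓ * (1 - t) / (1 + t) : ℝ) + Complex.I * ε) * (1 + t) / (x + Complex.I * ε + ℓ) := by
    push_cast
    field_simp
    ring
  rw [e3]
  generalize ((x - ℓ * (1 - t) / (1 + t) : ℝ) + Complex.I * ε : ℂ) = D at hd
  generalize (x + Complex.I * ε + ℓ : ℂ) = Z at hz
  have hstc : (Real.sqrt t : ℂ) ≠ 0 := by exact_mod_cast hst.ne'
  have hℓc : (ℓ : ℂ) ≠ 0 := by exact_mod_cast hℓ.ne'
  push_cast
  field_simp

lemma final_alg (ℓ s x : ℝ) (hx : x ∈ Set.Ioo (-ℓ) ℓ) :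
    (Real.sqrt (ℓ / Real.pi) : ℂ) / (x + ℓ) *
      (Real.pi / Complex.sin (Real.pi * (1 / 2 + Complex.I * s)) *
        Complex.exp ((Real.log ((ℓ - x) / (ℓ + x)) + Real.pi * Complex.I) *
          ((1 / 2 + Complex.I * s : ℂ) - 1)))
      = -(2*Real.pi*Complex.I) / (1 + Real.exp (2*Real.pi*s)) * PsiFun ℓ s x := by
  have h2 : 0 < ℓ - x := by linarith [hx.2]
  have h3 : 0 < ℓ + x := by linarith [hx.1]
  have hτ : 0 < (ℓ - x) / (ℓ + x) := by positivity
  have hτc : (((ℓ - x) / (ℓ + x) : ℝ) : ℂ) ≠ 0 := by exact_mod_cast hτ.ne'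
  rw [add_mul, Complex.exp_add, Complex.ofReal_log hτ.le, ← Complex.cpow_def_of_ne_zero hτc,
    cpow_half s _ hτ]
  have e1 : Complex.sin (Real.pi * (1 / 2 + Complex.I * s)) = Complex.cosh (Real.pi * s) := by
    rw [show (Real.pi * (1 / 2 + Complex.I * s) : ℂ) = (Real.pi * s : ℂ) * Complex.I + Real.pi / 2 by
      ring, Complex.sin_add_pi_div_two, Complex.cos_mul_I]
  have e2 : Complex.exp (Real.pi * Complex.I * ((1 / 2 + Complex.I * s : ℂ) - 1))
      = -Complex.I * Complex.exp (-(Real.pi * s)) := by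
    rw [show (Real.pi * Complex.I * ((1 / 2 + Complex.I * s : ℂ) - 1))
      = -(Real.pi / 2 * Complex.I) + -(Real.pi * s) by
        linear_combination (Real.pi * s : ℂ) * Complex.I_sq, Complex.exp_add, Complex.exp_neg,
      Complex.exp_pi_div_two_mul_I, Complex.inv_I]
  have e3 : (Real.sqrt (ℓ ^ 2 - x ^ 2))= (ℓ + x) * Real.sqrt ((ℓ - x) / (ℓ + x)) := by
    rw [show ℓ ^ 2 - x ^ 2 = ((ℓ + x) * Real.sqrt ((ℓ - x) / (ℓ + x))) ^ 2 by
      rw [mul_pow, Real.sq_sqrt hτ.le]; field_simp; ring]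
    exact Real.sqrt_sq (by positivity)
  have hs : Real.sqrt ((ℓ - x) / (ℓ + x)) ≠ 0 := (Real.sqrt_pos.2 hτ).ne'
  unfold PsiFun
  rw [e1, e2, e3, Complex.cosh, Complex.exp_neg]
  have e4 : ((Real.exp (2 * Real.pi * s) : ℝ) : ℂ) = Complex.exp (Real.pi * s) ^ 2 := by
    rw [← Complex.exp_nat_mul]; push_cast; congr 1; ring
  have hp : 0 < 1 + Real.exp (2 * Real.pi * s) := by positivity
  have hpc : (1 : ℂ) + Complex.exp (Real.pi * s) ^ 2 ≠ 0 := by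
    rw [← e4]; exact_mod_cast hp.ne'
  rw [e4]
  have hE := Complex.exp_ne_zero (Real.pi * s)
  generalize Complex.exp (Real.pi * s) = E at *
  generalize Real.sqrt ((ℓ - x) / (ℓ + x)) = T at *
  have hT : (T : ℂ) ≠ 0 := by exact_mod_cast hs
  have hL : (ℓ + x : ℂ) ≠ 0 := by exact_mod_cast h3.ne'
  have e5 : (E + E⁻¹) / 2 = (1 + E ^ 2) / (2 * E) := by field_simp; ring
  rw [e5, add_comm (x : ℂ) ℓ]
  push_cast
  field_simp

/-- For `ℓ > 0`, `x ∈ (-ℓ,ℓ)` and real `s`,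
`lim_{ε→0⁺} ∫_{-ℓ}^ℓ Ψ(s,y)/(x-y+iε) dy = -2πi/(1+e^{2πs}) Ψ(s,x)`. -/
theorem eigenvector_integral_limit (ℓ : ℝ) (hℓ : 0 < ℓ) (s x : ℝ)
    (hx : x ∈ Set.Ioo (-ℓ) ℓ) :
    Tendsto (fun ε : ℝ =>
        ∫ y in Set.Ioo (-ℓ) ℓ, PsiFun ℓ s y / ((x - y : ℝ) + Complex.I*ε))
      (nhdsWithin 0 (Set.Ioi 0))
      (nhds (-(2*Real.pi*Complex.I) / (1 + Real.exp (2*Real.pi*s)) * PsiFun ℓ s x)) := by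
  have h2 : 0 < ℓ - x := by linarith [hx.2]
  have h3 : 0 < ℓ + x := by linarith [hx.1]
  have hτ : 0 < (ℓ - x) / (ℓ + x) := by positivity
  have hL : (x + ℓ : ℂ) ≠ 0 := by rw [add_comm]; exact_mod_cast h3.ne'
  have hre : (1 / 2 + Complex.I * s : ℂ).re = 1 / 2 := by simp
  set W : ℝ → ℂ := fun ε => (x + Complex.I * ε - ℓ) / (x + Complex.I * ε + ℓ) with hW
  have hWim : ∀ ε : ℝ, 0 < ε → 0 < (W ε).im := by
    intro ε hε
    have hn : 0 < Complex.normSq (x + Complex.I * ε + ℓ) := by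
      rw [Complex.normSq_pos]
      intro h; have := congrArg Complex.im h; simp at this; exact hε.ne' this
    have : (W ε).im = 2 * ℓ * ε / Complex.normSq (x + Complex.I * ε + ℓ) := by
      simp only [hW, Complex.div_im]
      rw [← sub_div]
      congr 1
      simp
      ring
    rw [this]; positivity
  have hWlim : Tendsto W (nhdsWithin 0 (Set.Ioi 0)) (nhds (((-((ℓ - x) / (ℓ + x)) : ℝ)) : ℂ)) := by
    have hc : ContinuousAt W 0 := by
      apply ContinuousAt.div (by fun_prop) (by fun_prop)
      simpa using hL
    have h0 : W 0 = (((-((ℓ - x) / (ℓ + x)) : ℝ)) : ℂ) := by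
      simp only [hW]
      push_cast
      rw [add_comm (ℓ : ℂ) x, mul_zero, add_zero]
      ring
    rw [← h0]
    exact hc.tendsto.mono_left nhdsWithin_le_nhds
  have hlog : Tendsto (fun ε => Complex.log (W ε)) (nhdsWithin 0 (Set.Ioi 0))
      (nhds (Real.log ((ℓ - x) / (ℓ + x)) + Real.pi * Complex.I)) := by
    have hl := Complex.tendsto_log_nhdsWithin_im_nonneg_of_re_neg_of_im_zero
      (z := ((-((ℓ - x) / (ℓ + x)) : ℝ) : ℂ)) (by rw [Complex.ofReal_re]; linarith)
      (Complex.ofReal_im _)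
    rw [Complex.norm_real, norm_neg, Real.norm_of_nonneg hτ.le] at hl
    refine hl.comp (tendsto_nhdsWithin_iff.2 ⟨hWlim, ?_⟩)
    filter_upwards [self_mem_nhdsWithin] with ε hε
    exact (hWim ε hε).le
  rw [← final_alg ℓ s x hx]
  have hpre : Tendsto (fun ε : ℝ => (Real.sqrt (ℓ / Real.pi) : ℂ) / (x + Complex.I * ε + ℓ))
      (nhdsWithin 0 (Set.Ioi 0)) (nhds ((Real.sqrt (ℓ / Real.pi) : ℂ) / (x + ℓ))) := by
    have hc : ContinuousAt
        (fun ε : ℝ => (Real.sqrt (ℓ / Real.pi) : ℂ) / (x + Complex.I * ε + ℓ)) 0 := by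
      apply ContinuousAt.div (by fun_prop) (by fun_prop)
      simpa using hL
    have := hc.tendsto.mono_left (nhdsWithin_le_nhds (s := Set.Ioi 0))
    simpa using this
  have hmain := hpre.mul (((Complex.continuous_exp.tendsto _).comp
    (hlog.mul_const ((1 / 2 + Complex.I * s : ℂ) - 1))).const_mul
      (Real.pi / Complex.sin (Real.pi * (1 / 2 + Complex.I * s))))
  refine hmain.congr' ?_
  filter_upwards [self_mem_nhdsWithin] with ε hε
  have hε : 0 < ε := hε
  have hWs : W ε ∈ Complex.slitPlane := Or.inr (hWim ε hε).ne'
  rw [← phi_image ℓ hℓ, integral_image_eq_integral_abs_deriv_smul measurableSet_Ioi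
    (phi_deriv ℓ) (phi_inj ℓ hℓ),
    setIntegral_congr_fun measurableSet_Ioi (fun t ht => phi_point ℓ s x ε t hℓ hε ht),
    integral_const_mul, G_eq _ (by rw [hre]; norm_num) (by rw [hre]; norm_num) _ hWs,
    Complex.cpow_def_of_ne_zero (Complex.slitPlane_ne_zero hWs)]
  rfl
end
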